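/- There is a universal constant M with the following property: if A, G : [0,T] → M₂(ℝ) are functions with A differentiable, satisfying the evolution equation A'(t) + A(t) = G(t)(A(t)+I) − A(t)² and the pointwise bound |A(t)| ≤ 1/2 for all t ∈ [0,T], then for all t ∈ [0,T]: (d/dt)|A(t)|⁴ + |A(t)|⁴ ≤ M|G(t)|⁴. -/

import Mathlib

open MeasureTheory

noncomputable section

/-- 2×2 real matrices realized as nested functions. -/
abbrev M2 : Type := Fin 2 → Fin 2 → ℝ

/-- Squared Frobenius norm of a 2×2 matrix. -/
def nsq (A : M2) : ℝ := ∑ i, ∑ j, (A i j) ^ 2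

/-- The identity matrix. -/
def idM : M2 := fun i j => if i = j then 1 else 0

/-- Matrix product. -/
def matMul (X Y : M2) : M2 := fun i j => ∑ k, X i k * Y k j

/-- The Frobenius inner product of two 2×2 matrices. -/
def frobInner (X Y : M2) : ℝ := ∑ i, ∑ j, X i j * Y i j

lemma nsq_nonneg (X : M2) : 0 ≤ nsq X :=
  Finset.sum_nonneg fun _ _ => Finset.sum_nonneg fun _ _ => sq_nonneg _

lemma frobInner_sq_le (X Y : M2) : frobInner X Y ^ 2 ≤ nsq X * nsq Y := by
  simpa only [frobInner, nsq, Fintype.sum_prod_type] using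
    Finset.sum_mul_sq_le_sq_mul_sq Finset.univ
      (fun p : Fin 2 × Fin 2 => X p.1 p.2) (fun p => Y p.1 p.2)

lemma nsq_matMul_le (X Y : M2) : nsq (matMul X Y) ≤ nsq X * nsq Y := by
  calc nsq (matMul X Y)
      ≤ ∑ i, ∑ j, (∑ k, X i k ^ 2) * ∑ k, Y k j ^ 2 :=
        Finset.sum_le_sum fun i _ => Finset.sum_le_sum fun j _ =>
          Finset.sum_mul_sq_le_sq_mul_sq Finset.univ (X i) (fun k => Y k j)
    _ = nsq X * nsq Y := by
        simp only [nsq, Fin.sum_univ_two]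
        ring

lemma frobInner_evolution {A B G : M2}
    (h : B + A = matMul G (A + idM) - matMul A A) :
    frobInner A B =
      frobInner A (matMul G A) + frobInner A G - frobInner A (matMul A A) - nsq A := by
  have hB : B = matMul G (A + idM) - matMul A A - A := eq_sub_of_add_eq h
  subst hB
  simp [frobInner, matMul, nsq, idM, Fin.sum_univ_two]
  ring

lemma HasDerivAt.nsq_sq {A : ℝ → M2} {B : M2} {t : ℝ} (h : HasDerivAt A B t) :
    HasDerivAt (fun s => nsq (A s) ^ 2) (4 * nsq (A t) * frobInner (A t) B) t := by
  have hij (i j : Fin 2) : HasDerivAt (fun s => A s i j) (B i j) t :=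
    hasDerivAt_pi.1 (hasDerivAt_pi.1 h i) j
  have hn : HasDerivAt (fun s => nsq (A s)) (2 * frobInner (A t) B) t := by
    refine (HasDerivAt.fun_sum fun i _ => HasDerivAt.fun_sum fun j _ =>
      (hij i j).fun_pow 2).congr_deriv ?_
    simp only [frobInner, Fin.sum_univ_two]
    norm_num
    ring
  refine (hn.fun_pow 2).congr_deriv ?_
  norm_num
  ring

/-- there is a universal constant `M` such that whenever
`A, G : [0,T] → M₂(ℝ)` with `A` differentiable satisfy
`A' + A = G(A + I) − A²` and `|A| ≤ 1/2` pointwise on `[0,T]`, then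
`(d/dt)|A|⁴ + |A|⁴ ≤ M |G|⁴` on `[0,T]` (here `|A|⁴ = (nsq A)²`). -/
theorem statement_7 :
    ∃ M : ℝ, 0 < M ∧
      ∀ (T : ℝ) (A A' G : ℝ → M2),
        0 ≤ T →
        (∀ t ∈ Set.Icc (0:ℝ) T, HasDerivAt A (A' t) t) →
        (∀ t ∈ Set.Icc (0:ℝ) T,
          A' t + A t = matMul (G t) (A t + idM) - matMul (A t) (A t)) →
        (∀ t ∈ Set.Icc (0:ℝ) T, nsq (A t) ≤ 1/4) →
        ∀ t ∈ Set.Icc (0:ℝ) T,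
          deriv (fun s => (nsq (A s)) ^ 2) t + (nsq (A t)) ^ 2
            ≤ M * (nsq (G t)) ^ 2 := by
  refine ⟨200, by norm_num, fun T A A' G _ hA hev hle t ht => ?_⟩
  rw [(hA t ht).nsq_sq.deriv, frobInner_evolution (hev t ht)]
  have hquarter := hle t ht
  have hn := nsq_nonneg (A t)
  have hg := nsq_nonneg (G t)
  have hp := (frobInner_sq_le (A t) (matMul (G t) (A t))).trans
    (mul_le_mul_of_nonneg_left (nsq_matMul_le (G t) (A t)) hn)
  have hr := frobInner_sq_le (A t) (G t)
  have hq := (frobInner_sq_le (A t) (matMul (A t) (A t))).trans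
    (mul_le_mul_of_nonneg_left (nsq_matMul_le (A t) (A t)) hn)
  generalize nsq (A t) = n at *
  generalize nsq (G t) = g at *
  generalize frobInner (A t) (matMul (G t) (A t)) = p at *
  generalize frobInner (A t) (G t) = r at *
  generalize frobInner (A t) (matMul (A t) (A t)) = q at *
  have hq' : -q ≤ n / 2 :=
    (neg_le_abs q).trans (abs_le_of_sq_le_sq (by nlinarith [sq_nonneg n]) (by positivity))
  have hng : 0 ≤ n * g := mul_nonneg hn hg
  have hpr : p + r ≤ n / 8 + 5 * g := by
    refine (le_abs_self _).trans (abs_le_of_sq_le_sq ?_ (by positivity))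
    nlinarith [sq_nonneg (p - r), sq_nonneg (n / 8 - 5 * g)]
  nlinarith [mul_le_mul_of_nonneg_left hq' hn, mul_le_mul_of_nonneg_left hpr hn,
    sq_nonneg (n - 20 * g)]
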